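/- Let Z be a compact metrizable space, φ a continuous flow on Z, L ≥ 0, and let m be a Borel probability measure on Z. Let (P, m_P) be a probability space and p ↦ m_p a Markov kernel from P to Z (a measurable family of Borel probability measures on Z) such that for m_P-almost every p ∈ P, the measure m_p can be L-transported along φ to m. Then the mixture measure ∫_P m_p dm_P(p) can also be L-transported along φ to m. -/

import Mathlib

open MeasureTheory

/-- The set `Δ^L = {(x₁,x₂) : ∃ l ∈ [−L,L], x₂ = φ(l,x₁)}` associated to a flow `φ`. -/
def flowDelta {Z : Type*} [TopologicalSpace Z] (φ : Flow ℝ Z) (L : ℝ) : Set (Z × Z) :=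
  {p : Z × Z | ∃ l ∈ Set.Icc (-L) L, p.2 = φ l p.1}

/-- The topological support of a measure: points all of whose open neighborhoods
have positive measure. -/
def measureSupport {W : Type*} [TopologicalSpace W] [MeasurableSpace W]
    (M : Measure W) : Set W :=
  {x : W | ∀ U : Set W, IsOpen U → x ∈ U → M U ≠ 0}

/-- `m₁` can be `L`-transported along the flow `φ` to `m₂`: there is a Borel probability
measure `M` on `Z × Z` with topological support contained in `Δ^L`, whose first and
second marginals are `m₁` and `m₂` respectively. -/
def Transports {Z : Type*} [TopologicalSpace Z] [MeasurableSpace Z]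
    (φ : Flow ℝ Z) (L : ℝ) (m₁ m₂ : Measure Z) : Prop :=
  ∃ M : Measure (Z × Z), IsProbabilityMeasure M ∧
    measureSupport M ⊆ flowDelta φ L ∧
    M.map Prod.fst = m₁ ∧ M.map Prod.snd = m₂


open Filter Topology
open scoped NNReal ENNReal BoundedContinuousFunction

/-- Borel sets for the weak topology on probability measures are measurable for the
`σ`-algebra generated by the evaluations on measurable sets. -/
theorem opensMeasurableSpace_probabilityMeasure {X : Type*} [TopologicalSpace X]
    [MeasurableSpace X] [OpensMeasurableSpace X]
    [SecondCountableTopology (ProbabilityMeasure X)] :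
    OpensMeasurableSpace (ProbabilityMeasure X) := by
  have hgen : (inferInstance : TopologicalSpace (ProbabilityMeasure X)) =
      .generateFrom {s | ∃ (f : X →ᵇ ℝ≥0) (U : Set ℝ≥0∞), IsOpen U ∧
        s = (fun μ : ProbabilityMeasure X => ∫⁻ x, f x ∂(μ : Measure X)) ⁻¹' U} := by
    apply le_antisymm
    · refine le_generateFrom ?_
      rintro _ ⟨f, U, hU, rfl⟩
      exact hU.preimage (ProbabilityMeasure.continuous_lintegral_boundedContinuousFunction f)
    · rw [← continuous_id_iff_le]
      refine (@ProbabilityMeasure.continuous_iff_forall_continuous_lintegral _ _ _ _ _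
        (_) _).2 fun f => ?_
      refine @Continuous.mk _ _ (_) _ _ fun U hU => ?_
      exact TopologicalSpace.isOpen_generateFrom_of_mem ⟨f, U, hU, rfl⟩
  refine ⟨?_⟩
  rw [borel_eq_generateFrom_of_subbasis hgen]
  refine MeasurableSpace.generateFrom_le ?_
  rintro _ ⟨f, U, hU, rfl⟩
  have hf : Measurable fun x => (f x : ℝ≥0∞) :=
    (ENNReal.continuous_coe.comp f.continuous).measurable
  exact ((Measure.measurable_lintegral hf).comp measurable_subtype_coe) hU.measurableSet

theorem isClosed_flowDelta {Z : Type*} [TopologicalSpace Z] [CompactSpace Z] [T2Space Z]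
    (φ : Flow ℝ Z) (L : ℝ) : IsClosed (flowDelta φ L) := by
  have hc : Continuous fun q : ℝ × Z => (q.2, φ q.1 q.2) :=
    continuous_snd.prodMk (φ.continuous continuous_fst continuous_snd)
  have himage : flowDelta φ L =
      (fun q : ℝ × Z => (q.2, φ q.1 q.2)) '' (Set.Icc (-L) L ×ˢ Set.univ) := by
    ext ⟨x, y⟩
    constructor
    · rintro ⟨l, hl, h⟩
      obtain rfl : y = φ l x := h
      exact ⟨(l, x), ⟨hl, trivial⟩, rfl⟩
    · rintro ⟨⟨l, z⟩, ⟨hl, -⟩, h⟩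
      obtain ⟨rfl, rfl⟩ := Prod.mk.inj h
      exact ⟨l, hl, rfl⟩
  rw [himage]
  exact ((isCompact_Icc.prod isCompact_univ).image hc).isClosed

theorem measureSupport_subset_iff {W : Type*} [TopologicalSpace W] [SecondCountableTopology W]
    [MeasurableSpace W] (M : Measure W) {D : Set W} (hD : IsClosed D) :
    measureSupport M ⊆ D ↔ M Dᶜ = 0 := by
  constructor
  · intro h
    refine measure_null_of_locally_null _ fun x hx => ?_
    have hx' : x ∉ measureSupport M := fun hxM => hx (h hxM)
    simp only [measureSupport, Set.mem_ofPred_eq, not_forall, not_not] at hx'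
    obtain ⟨U, hU, hxU, hMU⟩ := hx'
    exact ⟨U, mem_nhdsWithin_of_mem_nhds (hU.mem_nhds hxU), hMU⟩
  · intro h x hx
    by_contra hxD
    exact hx _ hD.isOpen_compl hxD h

theorem isClosed_setOf_measure_eq_zero {X : Type*} [TopologicalSpace X] [MeasurableSpace X]
    [OpensMeasurableSpace X] [HasOuterApproxClosed X] {G : Set X} (hG : IsOpen G) :
    IsClosed {M : ProbabilityMeasure X | (M : Measure X) G = 0} := by
  rw [isClosed_iff_ultrafilter]
  intro M u hu hmem
  have hle := ProbabilityMeasure.le_liminf_measure_open_of_tendsto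
    (μs := id) (L := (u : Filter (ProbabilityMeasure X))) hu hG
  have hev : (fun N : ProbabilityMeasure X => (N : Measure X) G)
      =ᶠ[(u : Filter (ProbabilityMeasure X))] fun _ => 0 := hmem
  have hlim := liminf_congr hev
  rw [liminf_const] at hlim
  exact le_antisymm (hle.trans hlim.le) zero_le

/-- The mixture of a measurable family of probability measures. -/
noncomputable def mixture {P X : Type*} [MeasurableSpace P] [MeasurableSpace X]
    (m_P : Measure P) [IsProbabilityMeasure m_P] (f : P → ProbabilityMeasure X)
    (hf : Measurable f) : ProbabilityMeasure X :=
  ⟨m_P.bind fun p => (f p : Measure X),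
    isProbabilityMeasure_bind (measurable_subtype_coe.comp hf).aemeasurable
      (.of_forall fun _ => inferInstance)⟩

theorem mixture_apply {P X : Type*} [MeasurableSpace P] [MeasurableSpace X]
    (m_P : Measure P) [IsProbabilityMeasure m_P] (f : P → ProbabilityMeasure X)
    (hf : Measurable f) {s : Set X} (hs : MeasurableSet s) :
    (mixture m_P f hf : Measure X) s = ∫⁻ p, (f p : Measure X) s ∂m_P :=
  Measure.bind_apply hs (measurable_subtype_coe.comp hf).aemeasurable

theorem map_mixture {P X Y : Type*} [MeasurableSpace P] [MeasurableSpace X] [MeasurableSpace Y]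
    (m_P : Measure P) [IsProbabilityMeasure m_P] (f : P → ProbabilityMeasure X)
    (hf : Measurable f) {g : X → Y} (hg : Measurable g) {s : Set Y} (hs : MeasurableSet s) :
    (mixture m_P f hf : Measure X).map g s = ∫⁻ p, (f p : Measure X).map g s ∂m_P := by
  rw [Measure.map_apply hg hs, mixture_apply m_P f hf (hg hs)]
  simp_rw [Measure.map_apply hg hs]

/-- Mixtures depend continuously on the family, for almost everywhere convergence. -/
theorem tendsto_mixture {P X : Type*} [MeasurableSpace P] [TopologicalSpace X]
    [MeasurableSpace X] [OpensMeasurableSpace X]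
    (m_P : Measure P) [IsProbabilityMeasure m_P]
    {F : ℕ → P → ProbabilityMeasure X} (hF : ∀ n, Measurable (F n))
    {f : P → ProbabilityMeasure X} (hf : Measurable f)
    (hlim : ∀ᵐ p ∂m_P, Tendsto (fun n => F n p) atTop (𝓝 (f p))) :
    Tendsto (fun n => mixture m_P (F n) (hF n)) atTop (𝓝 (mixture m_P f hf)) := by
  rw [ProbabilityMeasure.tendsto_iff_forall_lintegral_tendsto]
  intro g
  have hg : Measurable fun x => (g x : ℝ≥0∞) :=
    (ENNReal.continuous_coe.comp g.continuous).measurable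
  have hint (h : P → ProbabilityMeasure X) (hh : Measurable h) :
      ∫⁻ x, g x ∂(mixture m_P h hh : Measure X) =
        ∫⁻ p, ∫⁻ x, g x ∂(h p : Measure X) ∂m_P :=
    Measure.lintegral_bind (measurable_subtype_coe.comp hh).aemeasurable hg.aemeasurable
  simp_rw [hint]
  refine tendsto_lintegral_of_dominated_convergence (fun _ => (nndist g 0 : ℝ≥0∞))
    (fun n => (Measure.measurable_lintegral hg).comp (measurable_subtype_coe.comp (hF n)))
    (fun n => .of_forall fun p => ?_) (by simp) ?_
  · calc ∫⁻ x, g x ∂(F n p : Measure X)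
        ≤ ∫⁻ _, (nndist g 0 : ℝ≥0∞) ∂(F n p : Measure X) :=
          lintegral_mono fun x => ENNReal.coe_le_coe.2 (BoundedContinuousFunction.NNReal.upper_bound g x)
      _ = nndist g 0 := by simp
  · filter_upwards [hlim] with p hp
    exact ProbabilityMeasure.tendsto_iff_forall_lintegral_tendsto.1 hp g

/-- mixtures can be transported: if `p ↦ κ p` is a Markov kernel from a
probability space `(P, m_P)` to `Z` such that for `m_P`-a.e. `p` the measure `κ p` can be
`L`-transported along `φ` to `m`, then the mixture `∫ κ p dm_P(p)` can be `L`-transported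
along `φ` to `m`. -/
theorem stmt_4 {Z : Type*} [TopologicalSpace Z] [CompactSpace Z]
    [TopologicalSpace.MetrizableSpace Z] [MeasurableSpace Z] [BorelSpace Z]
    {P : Type*} [MeasurableSpace P]
    (φ : Flow ℝ Z) (L : ℝ) (hL : 0 ≤ L)
    (m : Measure Z) [IsProbabilityMeasure m]
    (m_P : Measure P) [IsProbabilityMeasure m_P]
    (κ : ProbabilityTheory.Kernel P Z) [ProbabilityTheory.IsMarkovKernel κ]
    (h : ∀ᵐ p ∂m_P, Transports φ L (κ p) m) :
    Transports φ L (m_P.bind fun p => κ p) m := by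
  have : SecondCountableTopology Z := by
    let := TopologicalSpace.metrizableSpaceMetric Z
    infer_instance
  let : PseudoMetricSpace (ProbabilityMeasure Z) :=
    TopologicalSpace.pseudoMetrizableSpacePseudoMetric _
  have : SecondCountableTopology (ProbabilityMeasure Z) := inferInstance
  have : OpensMeasurableSpace (ProbabilityMeasure Z) := opensMeasurableSpace_probabilityMeasure
  let m' : ProbabilityMeasure Z := ⟨m, inferInstance⟩
  have hD := isClosed_flowDelta φ L
  let C : Set (ProbabilityMeasure (Z × Z)) :=
    {M | (M : Measure (Z × Z)) (flowDelta φ L)ᶜ = 0} ∩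
      {M | M.map continuous_snd.measurable.aemeasurable = m'}
  have hC : IsClosed C := (isClosed_setOf_measure_eq_zero hD.isOpen_compl).inter
    (isClosed_singleton.preimage (ProbabilityMeasure.continuous_map continuous_snd))
  let S : Set (ProbabilityMeasure Z) :=
    (fun M : ProbabilityMeasure (Z × Z) => M.map continuous_fst.measurable.aemeasurable) '' C
  have hS : IsClosed S :=
    (hC.isCompact.image (ProbabilityMeasure.continuous_map continuous_fst)).isClosed
  have hTS (μ : ProbabilityMeasure Z) : Transports φ L μ m ↔ μ ∈ S := by
    constructor
    · rintro ⟨M, hM, hsupp, h₁, h₂⟩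
      exact ⟨⟨M, hM⟩, ⟨(measureSupport_subset_iff M hD).1 hsupp, Subtype.ext h₂⟩, Subtype.ext h₁⟩
    · rintro ⟨M, ⟨hM, h₂⟩, h₁⟩
      exact ⟨M, inferInstance, (measureSupport_subset_iff _ hD).2 hM,
        congrArg Subtype.val h₁, congrArg Subtype.val h₂⟩
  let f : P → ProbabilityMeasure Z := fun p => ⟨κ p, inferInstance⟩
  have hf : Measurable f := κ.measurable.subtype_mk
  have hfS : ∀ᵐ p ∂m_P, f p ∈ S := h.mono fun p hp => (hTS (f p)).1 hp
  refine (hTS (mixture m_P f hf)).2 ?_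
  obtain ⟨p₀, hp₀⟩ := hfS.exists
  let F := SimpleFunc.approxOn f hf S (f p₀) hp₀
  refine hS.mem_of_tendsto (tendsto_mixture m_P (fun n => (F n).measurable) hf
    (hfS.mono fun p hp => SimpleFunc.tendsto_approxOn hf hp₀ (subset_closure hp)))
    (.of_forall fun n => ?_)
  have hFS (p : P) : F n p ∈ S := SimpleFunc.approxOn_mem hf hp₀ n p
  have hlift (μ : ProbabilityMeasure Z) (hμ : μ ∈ S) : ∃ M ∈ C,
      M.map continuous_fst.measurable.aemeasurable = μ := hμ
  have : Nonempty (ProbabilityMeasure (Z × Z)) := (hlift _ hp₀).nonempty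
  choose! c hcC hc using hlift
  have hG : Measurable fun p => c (F n p) := ((F n).map c).measurable
  refine ⟨mixture m_P (fun p => c (F n p)) hG, ⟨?_, ?_⟩, ?_⟩
  · refine (mixture_apply m_P _ hG hD.isOpen_compl.measurableSet).trans ?_
    simp_rw [show ∀ p, (c (F n p) : Measure (Z × Z)) (flowDelta φ L)ᶜ = 0 from
      fun p => (hcC _ (hFS p)).1, lintegral_zero]
  · refine Subtype.ext (Measure.ext fun s hs => ?_)
    refine (map_mixture m_P _ hG measurable_snd hs).trans ?_
    simp_rw [show ∀ p, (c (F n p) : Measure (Z × Z)).map Prod.snd = m from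
      fun p => congrArg Subtype.val (hcC _ (hFS p)).2]
    simp [m']
  · refine Subtype.ext (Measure.ext fun s hs => ?_)
    refine (map_mixture m_P _ hG measurable_fst hs).trans ?_
    simp_rw [show ∀ p, (c (F n p) : Measure (Z × Z)).map Prod.fst = F n p from
      fun p => congrArg Subtype.val (hc _ (hFS p))]
    exact (mixture_apply m_P _ (F n).measurable hs).symm
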